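/- For every sequence (Φ_n) of automorphisms of F there exist elements v_n ∈ F and a subsequence (n_i) such that, setting Ψ_{n_i} : x ↦ v_{n_i}⁻¹ Φ_{n_i}(x) v_{n_i}, no subsequence of the boundary homeomorphisms ∂Ψ_{n_i} converges μ_A-almost everywhere to a constant map from ∂F to ∂F. -/

import Mathlib

open MeasureTheory Filter Topology
open scoped ENNReal NNReal

namespace FGC

noncomputable section

variable (k : ℕ)

/-- The alphabet `A = Σ ∪ Σ⁻¹`: a letter is a basis element together with a sign. -/
abbrev L := Fin k × Bool

/-- The inverse of a letter. -/
def linv (a : L k) : L k := (a.1, !a.2)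

/-- A right-infinite word is (freely) reduced if no letter is followed by its inverse. -/
def Red (x : ℕ → L k) : Prop := ∀ n, x (n + 1) ≠ linv k (x n)

/-- The boundary `∂F`: the set of infinite freely reduced words in the alphabet `A`. -/
def Boundary : Type := { x : ℕ → L k // Red k x }

instance : TopologicalSpace (Boundary k) :=
  inferInstanceAs (TopologicalSpace { x : ℕ → L k // Red k x })

instance : MeasurableSpace (Boundary k) := borel _

instance : BorelSpace (Boundary k) := ⟨rfl⟩

/-- The free group of rank `k`. -/
abbrev F := FreeGroup (Fin k)

/-- The word length `|v|` of an element of `F`. -/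
def wordLength (v : F k) : ℕ := v.toWord.length

/-- The cyclically reduced length `‖v‖`: the minimal word length among conjugates of `v`. -/
def cyclLength (v : F k) : ℕ := sInf { n | ∃ g : F k, wordLength k (g * v * g⁻¹) = n }

/-- The cylinder `Cyl v ⊆ ∂F` of rays starting with the reduced word of `v`. -/
def Cyl (v : F k) : Set (Boundary k) :=
  { x | ∀ i : Fin v.toWord.length, x.1 i = v.toWord.get i }

/-- The shift deleting the first letter of a ray. -/
def shift (x : ℕ → L k) : ℕ → L k := fun n => x (n + 1)

/-- Prepending a letter to a ray. -/
def cons (a : L k) (x : ℕ → L k) : ℕ → L k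
  | 0 => a
  | n + 1 => x n

/-- Prepending a (reversed) finite word to a ray, performing free reduction. -/
def prependAux : List (L k) → (ℕ → L k) → ℕ → L k
  | [], x => x
  | a :: r, x => prependAux r (if x 0 = linv k a then shift k x else cons k a x)

theorem red_shift {x : ℕ → L k} (hx : Red k x) : Red k (shift k x) :=
  fun n => hx (n + 1)

theorem red_cons {a : L k} {x : ℕ → L k} (hx : Red k x) (h : x 0 ≠ linv k a) :
    Red k (cons k a x) := by
  intro n
  cases n with
  | zero => exact h
  | succ m => exact hx m

theorem red_prependAux : ∀ (r : List (L k)) {x : ℕ → L k}, Red k x → Red k (prependAux k r x)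
  | [], _, hx => hx
  | a :: r, x, hx => by
    by_cases h : x 0 = linv k a
    · simp only [prependAux, if_pos h]
      exact red_prependAux r (red_shift k hx)
    · simp only [prependAux, if_neg h]
      exact red_prependAux r (red_cons k hx h)

/-- The left-translation action of `F` on `∂F`: concatenate and freely reduce. -/
def act (g : F k) (x : Boundary k) : Boundary k :=
  ⟨prependAux k g.toWord.reverse x.1, red_prependAux k _ x.2⟩

/-- The shift map `T : ∂F → ∂F`. -/
def Tmap (x : Boundary k) : Boundary k := ⟨shift k x.1, red_shift k x.2⟩

/-- The double boundary `∂²F`, as the complement of the diagonal. -/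
def D2 : Set (Boundary k × Boundary k) := { p | p.1 ≠ p.2 }

/-- The diagonal action of `F` on `∂F × ∂F`. -/
def actPair (g : F k) (p : Boundary k × Boundary k) : Boundary k × Boundary k :=
  (act k g p.1, act k g p.2)

/-- The cylinder `Cyl[1,w]` of geodesics through the segment from `1` to `w`. -/
def baseCyl (w : F k) : Set (Boundary k × Boundary k) :=
  { p | p.1.1 0 ≠ p.2.1 0 ∧ p.2 ∈ Cyl k w }

/-- The base-ball `B = Cyl[1,1]` of geodesics through the base point. -/
def baseBall : Set (Boundary k × Boundary k) := baseCyl k 1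

/-- The cylinder `Cyl[x,y] = x · Cyl[1, x⁻¹y]`. -/
def Cyl2 (x y : F k) : Set (Boundary k × Boundary k) :=
  actPair k x '' baseCyl k (x⁻¹ * y)

/-- A geodesic current: a Borel measure on `∂F × ∂F` giving no mass to the diagonal,
invariant under the diagonal `F`-action, and finite on compact subsets of `∂²F`. -/
def IsCurrent (η : Measure (Boundary k × Boundary k)) : Prop :=
  η { p | p.1 = p.2 } = 0 ∧
  (∀ g : F k, ∀ W : Set (Boundary k × Boundary k), MeasurableSet W →
    η (actPair k g ⁻¹' W) = η W) ∧
  (∀ K : Set (Boundary k × Boundary k), K ⊆ D2 k → IsCompact K → η K < ⊤)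

/-- The element of `F` given by the first `n` letters of a ray. -/
def prefixEl (x : Boundary k) (n : ℕ) : F k :=
  FreeGroup.mk (List.ofFn fun i : Fin n => x.1 i)

/-- `b : ∂F → ∂F` is the boundary extension of the automorphism `Φ`: for every ray `x`
and every `m`, the length-`m` prefix of `b x` is the length-`m` prefix of the reduced
word of `Φ (x|_n)` for all sufficiently large `n`. -/
def IsBdryExt (Φ : F k ≃* F k) (b : Boundary k → Boundary k) : Prop :=
  ∀ x : Boundary k, ∀ m : ℕ, ∃ N : ℕ, ∀ n ≥ N,
    (Φ (prefixEl k x n)).toWord.take m = List.ofFn fun i : Fin m => (b x).1 i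

/-- The map `∂Φ × ∂Φ` on pairs. -/
def pairMap (b : Boundary k → Boundary k) (p : Boundary k × Boundary k) :
    Boundary k × Boundary k := (b p.1, b p.2)

/-- The length of an automorphism with boundary map `b`, w.r.t. the current `η`:
`L(Φ) = η((∂Φ × ∂Φ)⁻¹ B)`. -/
def autLen (η : Measure (Boundary k × Boundary k)) (b : Boundary k → Boundary k) : ℝ≥0∞ :=
  η (pairMap k b ⁻¹' baseBall k)

/-- The subgroup of inner automorphisms. -/
abbrev Inn : Subgroup (MulAut (F k)) := (MulAut.conj : F k →* MulAut (F k)).range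

/-- `Out(F) = Aut(F)/Inn(F)` as a coset space. -/
abbrev OutQ := MulAut (F k) ⧸ Inn k

/-- A simple automorphism: induced by a permutation of the basis, or inner. -/
def SimpleAut (Φ : MulAut (F k)) : Prop :=
  (∃ σ : Equiv.Perm (Fin k), ∀ i, Φ (FreeGroup.of i) = FreeGroup.of (σ i)) ∨
  (∃ v : F k, ∀ x, Φ x = v * x * v⁻¹)

/-- A Whitehead automorphism of the second kind. -/
def Whitehead2 (τ : MulAut (F k)) : Prop :=
  ∃ a : Fin k, ∀ i : Fin k,
    τ (FreeGroup.of i) = FreeGroup.of i ∨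
    τ (FreeGroup.of i) = FreeGroup.of i * FreeGroup.of a ∨
    τ (FreeGroup.of i) = (FreeGroup.of a)⁻¹ * FreeGroup.of i ∨
    τ (FreeGroup.of i) = (FreeGroup.of a)⁻¹ * FreeGroup.of i * FreeGroup.of a

/-- The space of frequency measures: finite `T`-invariant Borel measures on `∂F`. -/
def FreqM : Type :=
  { μ : Measure (Boundary k) //
    IsFiniteMeasure μ ∧ ∀ W : Set (Boundary k), MeasurableSet W → μ (Tmap k ⁻¹' W) = μ W }

/-- The space of geodesic currents. -/
def Currents : Type := { η : Measure (Boundary k × Boundary k) // IsCurrent k η }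

/-- Continuous functions on `∂F × ∂F` with compact support contained in `∂²F`;
these are the test functions for the weak-* topology on currents. -/
def TestF : Type :=
  { φ : Boundary k × Boundary k → ℝ //
    Continuous φ ∧ IsCompact (tsupport φ) ∧ tsupport φ ⊆ D2 k }

/-- The weak-* topology on frequency measures. -/
instance : TopologicalSpace (FreqM k) :=
  ⨅ φ : C(Boundary k, ℝ),
    TopologicalSpace.induced (fun μ : FreqM k => ∫ x, φ x ∂μ.1) inferInstance

/-- The weak-* topology on geodesic currents. -/
instance : TopologicalSpace (Currents k) :=
  ⨅ φ : TestF k,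
    TopologicalSpace.induced (fun η : Currents k => ∫ p, φ.1 p ∂η.1) inferInstance

/-- Convergence of a sequence of group elements (as reduced words) to a boundary ray. -/
def WordTendsto (pn : ℕ → F k) (p : Boundary k) : Prop :=
  ∀ m : ℕ, ∃ N : ℕ, ∀ n ≥ N, (pn n).toWord.take m = List.ofFn fun i : Fin m => p.1 i

/-- The length of the maximal common initial segment of two rays. -/
def commonLen (p : Boundary k × Boundary k) : ℕ :=
  sSup { m : ℕ | ∀ i < m, p.1.1 i = p.2.1 i }

/-- A single letter as an element of `F`. -/
def el (a : L k) : F k := FreeGroup.mk [a]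

/-- The product of per-letter constants over the reduced word of `w`. -/
def Cprod (C : L k → ℝ≥0) (w : F k) : ℝ≥0 := (w.toWord.map C).prod

variable {k}

section Words

theorem linv_linv (a : L k) : linv k (linv k a) = a := by
  simp [linv]

theorem el_inv (a : L k) : (el k a)⁻¹ = el k (linv k a) := by
  simp [el, linv, FreeGroup.invRev]

theorem mk_cons_eq (a : L k) (t : List (L k)) :
    (FreeGroup.mk (a :: t) : F k) = el k a * FreeGroup.mk t := by
  simp [el]

theorem toWord_mk_of_isReduced {l : List (L k)} (h : FreeGroup.IsReduced l) :
    (FreeGroup.mk l : F k).toWord = l := by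
  rw [FreeGroup.toWord_mk, h.reduce_eq]

theorem ne_linv_iff {a b : L k} : b ≠ linv k a ↔ (a.1 = b.1 → a.2 = b.2) := by
  obtain ⟨a, s⟩ := a
  obtain ⟨b, t⟩ := b
  simp only [linv, ne_eq, Prod.mk.injEq]
  cases s <;> cases t <;> simp [eq_comm]

theorem toWord_mul_el_of_append {g : F k} {p s : List (L k)} (hg : g.toWord = p ++ s)
    (hs : s ≠ []) (a : L k) :
    ∃ s', (g * el k a).toWord = p ++ s' ∧ s.length ≤ s'.length + 1 := by
  have hred : FreeGroup.IsReduced (p ++ s) := hg ▸ FreeGroup.isReduced_toWord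
  have hmk : g = FreeGroup.mk (p ++ s) := by rw [← hg, FreeGroup.mk_toWord]
  obtain ⟨t, b, rfl⟩ : ∃ t b, s = t ++ [b] :=
    ⟨s.dropLast, s.getLast hs, (List.dropLast_append_getLast hs).symm⟩
  by_cases hb : b = linv k a
  · refine ⟨t, ?_, by simp⟩
    have : g * el k a = FreeGroup.mk (p ++ t) := by
      have hb' : (FreeGroup.mk [b] : F k) = (el k a)⁻¹ := by rw [el_inv, hb]; rfl
      rw [hmk, ← List.append_assoc, ← FreeGroup.mul_mk, hb', inv_mul_cancel_right]
    rw [this, toWord_mk_of_isReduced]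
    exact hred.infix ⟨[], [b], by simp⟩
  · refine ⟨t ++ [b] ++ [a], ?_, by simp⟩
    rw [hmk, el, FreeGroup.mul_mk, toWord_mk_of_isReduced, List.append_assoc]
    have hba : FreeGroup.IsReduced [b, a] :=
      FreeGroup.isReduced_cons_cons.2
        ⟨ne_linv_iff.1 fun h => hb (by rw [h, linv_linv]), FreeGroup.IsReduced.singleton⟩
    have := FreeGroup.IsReduced.append_overlap (L₁ := p ++ t) (L₂ := [b]) (L₃ := [a])
      (by simpa using hred) hba (by simp)
    simpa using this

theorem toWord_mul_mk_of_append {p : List (L k)} (w : List (L k)) {g : F k} {s : List (L k)}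
    (hg : g.toWord = p ++ s) (hs : w.length ≤ s.length) :
    ∃ s', (g * FreeGroup.mk w).toWord = p ++ s' := by
  induction w generalizing g s with
  | nil => exact ⟨s, by rw [← hg, ← FreeGroup.one_eq_mk, mul_one]⟩
  | cons a w ih =>
    have hne : s ≠ [] := by rintro rfl; simp at hs
    obtain ⟨s', h', hl⟩ := toWord_mul_el_of_append hg hne a
    rw [mk_cons_eq, ← mul_assoc]
    exact ih h' (by simp at hs; omega)

theorem toWord_el_inv_mul_of_eq {g : F k} {a : L k} {t : List (L k)} (hg : g.toWord = a :: t) :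
    ((el k a)⁻¹ * g).toWord = t := by
  have hred : FreeGroup.IsReduced (a :: t) := hg ▸ FreeGroup.isReduced_toWord
  rw [← FreeGroup.mk_toWord (x := g), hg, mk_cons_eq, inv_mul_cancel_left,
    toWord_mk_of_isReduced (hred.infix ⟨[a], [], by simp⟩)]

theorem toWord_el_inv_mul_of_ne {g : F k} {a c : L k} {t : List (L k)} (hg : g.toWord = c :: t)
    (hc : c ≠ a) : ((el k a)⁻¹ * g).toWord = linv k a :: c :: t := by
  have hred : FreeGroup.IsReduced (c :: t) := hg ▸ FreeGroup.isReduced_toWord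
  rw [← FreeGroup.mk_toWord (x := g), hg, el_inv, ← mk_cons_eq, toWord_mk_of_isReduced]
  rw [FreeGroup.isReduced_cons_cons, ← ne_linv_iff, linv_linv]
  exact ⟨hc, hred⟩

end Words

section Rays

/-- The word formed by the first `m` letters of a ray. -/
def initWord (x : ℕ → L k) (m : ℕ) : List (L k) := List.ofFn fun i : Fin m => x i

@[simp] theorem length_initWord (x : ℕ → L k) (m : ℕ) : (initWord x m).length = m := by
  simp [initWord]

theorem initWord_succ (x : ℕ → L k) (m : ℕ) :
    initWord x (m + 1) = x 0 :: initWord (shift k x) m := by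
  simp [initWord, List.ofFn_succ, shift]

theorem initWord_succ' (x : ℕ → L k) (m : ℕ) :
    initWord x (m + 1) = initWord x m ++ [x m] := by
  rw [initWord, List.ofFn_succ_last]
  simp [initWord]

theorem isReduced_initWord {x : ℕ → L k} (hx : Red k x) (m : ℕ) :
    FreeGroup.IsReduced (initWord x m) := by
  rw [FreeGroup.IsReduced, List.isChain_iff_getElem]
  intro i hi
  rw [← ne_linv_iff]
  simpa [initWord] using hx i

theorem eq_of_initWord_eq {x y : ℕ → L k} (h : ∀ m, initWord x m = initWord y m) : x = y := by
  funext m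
  have := h (m + 1)
  rw [initWord_succ', initWord_succ'] at this
  simpa using (List.append_inj' this rfl).2

theorem prefixEl_eq (x : Boundary k) (n : ℕ) : prefixEl k x n = FreeGroup.mk (initWord x.1 n) :=
  rfl

theorem prefixEl_succ (x : Boundary k) (n : ℕ) :
    prefixEl k x (n + 1) = prefixEl k x n * el k (x.1 n) := by
  rw [prefixEl_eq, prefixEl_eq, initWord_succ', el, FreeGroup.mul_mk]

theorem norm_prefixEl (x : Boundary k) (n : ℕ) : (prefixEl k x n).norm = n := by
  rw [FreeGroup.norm, prefixEl_eq, toWord_mk_of_isReduced (isReduced_initWord x.2 n),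
    length_initWord]

theorem isReduced_invRev {l : List (L k)} (h : FreeGroup.IsReduced l) :
    FreeGroup.IsReduced (FreeGroup.invRev l) := by
  rw [FreeGroup.isReduced_iff_reduce_eq, FreeGroup.reduce_invRev, h.reduce_eq]

theorem norm_inv_prefixEl_mul_prefixEl {x y : Boundary k} (h : x.1 0 ≠ y.1 0) (m n : ℕ) :
    ((prefixEl k x m)⁻¹ * prefixEl k y n).norm = m + n := by
  rcases m with _ | m
  · simp [prefixEl_eq x, initWord, ← FreeGroup.one_eq_mk, norm_prefixEl]
  rcases n with _ | n
  · simp [prefixEl_eq y, initWord, ← FreeGroup.one_eq_mk, norm_prefixEl]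
  rw [FreeGroup.norm, prefixEl_eq, prefixEl_eq, FreeGroup.inv_mk, FreeGroup.mul_mk,
    toWord_mk_of_isReduced]
  · simp
  have hx := isReduced_invRev (isReduced_initWord x.2 (m + 1))
  have hy := isReduced_initWord y.2 (n + 1)
  rw [FreeGroup.IsReduced, List.isChain_append]
  refine ⟨hx, hy, ?_⟩
  simp only [initWord_succ, FreeGroup.invRev, List.map_cons, List.reverse_cons,
    List.getLast?_append, List.head?_cons]
  simp only [← ne_linv_iff]
  simpa [linv, eq_comm] using h

end Rays

section BoundaryExtension

variable {Φ : MulAut (F k)} {b b' : Boundary k → Boundary k}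

theorem IsBdryExt.eventually_prefix (h : IsBdryExt k Φ b) (x : Boundary k) (m : ℕ) :
    ∀ᶠ n in atTop, initWord (b x).1 m <+: (Φ (prefixEl k x n)).toWord := by
  obtain ⟨N, hN⟩ := h x m
  filter_upwards [eventually_ge_atTop N] with n hn
  rw [initWord, ← hN n hn]
  exact List.take_prefix _ _

theorem IsBdryExt.initWord_eq_of_eventually (h : IsBdryExt k Φ b) (x : Boundary k)
    {l : List (L k)} (hl : ∀ᶠ n in atTop, l <+: (Φ (prefixEl k x n)).toWord) :
    initWord (b x).1 l.length = l := by
  obtain ⟨n, h₁, h₂⟩ := ((h.eventually_prefix x l.length).and hl).exists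
  exact (List.prefix_of_prefix_length_le h₁ h₂ (by simp)).eq_of_length (by simp)

theorem exists_norm_apply_el_le (Φ : MulAut (F k)) : ∃ C : ℕ, ∀ a, (Φ (el k a)).norm ≤ C := by
  obtain ⟨C, hC⟩ := (Set.finite_range fun a : L k => (Φ (el k a)).norm).bddAbove
  exact ⟨C, fun a => hC ⟨a, rfl⟩⟩

theorem norm_apply_le {Φ : MulAut (F k)} {C : ℕ} (hC : ∀ a, (Φ (el k a)).norm ≤ C) (g : F k) :
    (Φ g).norm ≤ C * g.norm := by
  suffices ∀ w : List (L k), (Φ (FreeGroup.mk w)).norm ≤ C * w.length by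
    simpa only [FreeGroup.mk_toWord, FreeGroup.norm] using this g.toWord
  intro w
  induction w with
  | nil => simp [← FreeGroup.one_eq_mk]
  | cons a w ih =>
    rw [mk_cons_eq, map_mul]
    refine (FreeGroup.norm_mul_le _ _).trans ?_
    rw [List.length_cons, mul_add, mul_one, add_comm]
    exact add_le_add ih (hC a)

theorem IsBdryExt.exists_toWord_eq_append (h : IsBdryExt k Φ b) {C : ℕ}
    (hC : ∀ a, (Φ (el k a)).norm ≤ C) (x : Boundary k) (m : ℕ) :
    ∃ j s, (Φ (prefixEl k x j)).toWord = initWord (b x).1 (m + 1) ++ s ∧ s.length ≤ C := by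
  classical
  have hex := (h.eventually_prefix x (m + 1)).exists
  obtain ⟨s, hs⟩ := Nat.find_spec hex
  refine ⟨Nat.find hex, s, hs.symm, ?_⟩
  by_contra! hlt
  rcases hj : Nat.find hex with _ | i
  · rw [hj, prefixEl_eq] at hs
    simp [initWord, ← FreeGroup.one_eq_mk] at hs
  · refine Nat.find_min hex (m := i) (by omega) ?_
    rw [hj] at hs
    have hi : Φ (prefixEl k x i) =
        Φ (prefixEl k x (i + 1)) * FreeGroup.mk (Φ (el k (linv k (x.1 i)))).toWord := by
      rw [FreeGroup.mk_toWord, prefixEl_succ, ← el_inv, ← map_mul, mul_inv_cancel_right]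
    obtain ⟨t, ht⟩ := toWord_mul_mk_of_append _ hs.symm ((hC (linv k (x.1 i))).trans hlt.le)
    exact ⟨t, by rw [hi, ht]⟩

/-- Rays with the same image under a boundary extension have the same first letter. -/
theorem IsBdryExt.zero_eq_of_apply_eq (h : IsBdryExt k Φ b) {x y : Boundary k}
    (hxy : b x = b y) : x.1 0 = y.1 0 := by
  by_contra hne
  obtain ⟨C, hC⟩ := exists_norm_apply_el_le Φ
  obtain ⟨D, hD⟩ := exists_norm_apply_el_le Φ⁻¹
  obtain ⟨i, s, hs, hsC⟩ := h.exists_toWord_eq_append hC x (C * (D * (C + C)))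
  obtain ⟨j, t, ht, htC⟩ := h.exists_toWord_eq_append hC y (C * (D * (C + C)))
  have hst : ((Φ (prefixEl k x i))⁻¹ * Φ (prefixEl k y j)).norm ≤ C + C := by
    have : (Φ (prefixEl k x i))⁻¹ * Φ (prefixEl k y j) =
        (FreeGroup.mk s)⁻¹ * FreeGroup.mk t := by
      rw [← FreeGroup.mk_toWord (x := Φ (prefixEl k x i)),
        ← FreeGroup.mk_toWord (x := Φ (prefixEl k y j)), hs, ht, hxy, ← FreeGroup.mul_mk,
        ← FreeGroup.mul_mk]
      group
    rw [this]
    refine (FreeGroup.norm_mul_le _ _).trans (add_le_add ?_ ?_)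
    · rw [FreeGroup.norm_inv_eq]
      exact FreeGroup.norm_mk_le.trans hsC
    · exact FreeGroup.norm_mk_le.trans htC
  have hij : i + j ≤ D * (C + C) := by
    rw [← norm_inv_prefixEl_mul_prefixEl hne i j]
    have : (prefixEl k x i)⁻¹ * prefixEl k y j =
        Φ⁻¹ ((Φ (prefixEl k x i))⁻¹ * Φ (prefixEl k y j)) := by
      rw [← map_inv, ← map_mul, MulAut.inv_apply_self]
    rw [this]
    exact (norm_apply_le hD _).trans (Nat.mul_le_mul_left D hst)
  have hi := norm_apply_le hC (prefixEl k x i)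
  rw [norm_prefixEl, FreeGroup.norm, hs, List.length_append, length_initWord] at hi
  have := Nat.mul_le_mul_left C ((Nat.le_add_right i j).trans hij)
  omega

theorem IsBdryExt.conj_el_zero (h : IsBdryExt k Φ b) {a : L k}
    (h' : IsBdryExt k ((MulAut.conj (el k a))⁻¹ * Φ) b') {x : Boundary k}
    (hx : (b x).1 0 ≠ a) : (b' x).1 0 = linv k a := by
  have key : ∀ᶠ n in atTop,
      [linv k a] <+: (((MulAut.conj (el k a))⁻¹ * Φ) (prefixEl k x n)).toWord := by
    filter_upwards [h.eventually_prefix x 1] with n ⟨t, ht⟩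
    rw [MulAut.mul_apply, MulAut.conj_inv_apply]
    have := toWord_el_inv_mul_of_ne (g := Φ (prefixEl k x n)) (t := t)
      (by rw [← ht, initWord_succ]; rfl) hx
    obtain ⟨s, hs, -⟩ := toWord_mul_el_of_append (p := [linv k a]) this (by simp) a
    exact ⟨s, hs.symm⟩
  simpa [initWord] using h'.initWord_eq_of_eventually x key

theorem IsBdryExt.conj_el_eq_shift (h : IsBdryExt k Φ b) {a : L k}
    (h' : IsBdryExt k ((MulAut.conj (el k a))⁻¹ * Φ) b') {x : Boundary k}
    (hx : (b x).1 0 = a) : (b' x).1 = shift k (b x).1 := by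
  refine eq_of_initWord_eq fun m => ?_
  have key : ∀ᶠ n in atTop, initWord (shift k (b x).1) m <+:
      (((MulAut.conj (el k a))⁻¹ * Φ) (prefixEl k x n)).toWord := by
    filter_upwards [h.eventually_prefix x (m + 2)] with n ⟨t, ht⟩
    rw [MulAut.mul_apply, MulAut.conj_inv_apply]
    have := toWord_el_inv_mul_of_eq (g := Φ (prefixEl k x n)) (a := a)
      (t := initWord (shift k (b x).1) (m + 1) ++ t) (by rw [← ht, initWord_succ, hx]; rfl)
    rw [initWord_succ', List.append_assoc] at this
    obtain ⟨s, hs, -⟩ := toWord_mul_el_of_append this (by simp) a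
    exact ⟨s, hs.symm⟩
  simpa using h'.initWord_eq_of_eventually x key

theorem measurableSet_prefixEl (n : ℕ) (P : F k → Prop) :
    MeasurableSet {x : Boundary k | P (prefixEl k x n)} := by
  have hc : Continuous fun (x : Boundary k) (i : Fin n) => x.1 i :=
    continuous_pi fun i => (continuous_apply (i : ℕ)).comp continuous_subtype_val
  exact ((isOpen_discrete {w : Fin n → L k | P (FreeGroup.mk (List.ofFn w))}).preimage
    hc).measurableSet

theorem IsBdryExt.measurableSet_zero_eq (h : IsBdryExt k Φ b) (a : L k) :
    MeasurableSet {x | (b x).1 0 = a} := by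
  have : {x | (b x).1 0 = a} =
      {x | ∀ᶠ n in atTop, [a] <+: (Φ (prefixEl k x n)).toWord} := by
    ext x
    constructor
    · intro hx
      have hx : (b x).1 0 = a := hx
      simpa [initWord, hx] using h.eventually_prefix x 1
    · intro hx
      simpa [initWord] using h.initWord_eq_of_eventually x hx
  rw [this]
  simp only [eventually_atTop, Set.ofPred_exists, Set.ofPred_forall]
  exact .iUnion fun _ => .iInter fun n => .iInter fun _ =>
    measurableSet_prefixEl n fun g => [a] <+: (Φ g).toWord

end BoundaryExtension

section Median

/-- After composing with a suitable inner automorphism, the image measure on the boundary gives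
each one-letter cylinder mass at most one half. -/
theorem exists_conj_measure_zero_eq_le {μ : Measure (Boundary k)} [IsProbabilityMeasure μ]
    (hμ : ∀ a, μ {x | x.1 0 = a} < 2⁻¹) {bd : MulAut (F k) → Boundary k → Boundary k}
    (hbd : ∀ Φ : MulAut (F k), IsBdryExt k Φ (bd Φ)) (Φ : MulAut (F k)) :
    ∃ v : F k, ∀ a, μ {x | (bd ((MulAut.conj v)⁻¹ * Φ) x).1 0 = a} ≤ 2⁻¹ := by
  by_contra! hcon
  choose a ha using hcon
  let w : ℕ → F k := fun n => Nat.rec 1 (fun _ v => v * el k (a v)) n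
  let b : ℕ → Boundary k → Boundary k := fun n => bd ((MulAut.conj (w n))⁻¹ * Φ)
  let r : ℕ → L k := fun n => a (w n)
  let E : ℕ → Set (Boundary k) := fun n => {x | (b n x).1 0 = r n}
  have hE : ∀ n, 2⁻¹ < μ (E n) := fun n => ha (w n)
  have hEm : ∀ n, MeasurableSet (E n) := fun n => (hbd _).measurableSet_zero_eq _
  have hb : ∀ n, IsBdryExt k ((MulAut.conj (el k (r n)))⁻¹ * ((MulAut.conj (w n))⁻¹ * Φ))
      (b (n + 1)) := by
    intro n
    rw [← mul_assoc, ← mul_inv_rev, ← map_mul]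
    exact hbd _
  have hr : ∀ n, r (n + 1) ≠ linv k (r n) := by
    intro n hn
    have hsub : E (n + 1) ⊆ (E n)ᶜ := by
      intro x hx hx'
      have h0 : (b (n + 1) x).1 0 = r (n + 1) := hx
      have h1 : (b n x).1 0 = r n := hx'
      rw [(hbd _).conj_el_eq_shift (hb n) h1, hn, ← h1] at h0
      exact (b n x).2 0 h0
    have hlt := ENNReal.add_lt_add (hE n) ((hE (n + 1)).trans_le (measure_mono hsub))
    rw [prob_add_prob_compl (hEm n), ENNReal.inv_two_add_inv_two] at hlt
    exact hlt.false
  have hanti : Antitone E := by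
    refine antitone_nat_of_succ_le fun n x hx => ?_
    by_contra hx'
    have h0 : (b (n + 1) x).1 0 = r (n + 1) := hx
    exact hr n (h0 ▸ (hbd _).conj_el_zero (hb n) hx')
  have hinter : 2⁻¹ ≤ μ (⋂ n, E n) := by
    rw [hanti.measure_iInter (fun n => (hEm n).nullMeasurableSet) ⟨0, measure_ne_top _ _⟩]
    exact le_iInf fun n => (hE n).le
  have hbr : ∀ x ∈ ⋂ n, E n, (b 0 x).1 = r := by
    intro x hx
    have hx : ∀ n, (b n x).1 0 = r n := fun n => Set.mem_iInter.1 hx n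
    have hshift : ∀ n m, (b n x).1 m = (b 0 x).1 (n + m) := by
      intro n
      induction n with
      | zero => simp
      | succ n ih =>
        intro m
        rw [(hbd _).conj_el_eq_shift (hb n) (hx n), shift]
        refine (ih (m + 1)).trans ?_
        rw [add_right_comm, add_assoc]
    funext n
    rw [← hx n, hshift n 0, add_zero]
  obtain ⟨x, hx⟩ : (⋂ n, E n).Nonempty := by
    refine nonempty_of_measure_ne_zero (μ := μ) fun h0 => ?_
    simp [h0] at hinter
  have hsub : (⋂ n, E n) ⊆ {y | y.1 0 = x.1 0} := fun y hy =>
    (hbd _).zero_eq_of_apply_eq (Subtype.ext ((hbr y hy).trans (hbr x hx).symm))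
  exact ((hinter.trans (measure_mono hsub)).trans_lt (hμ _)).false

theorem not_ae_tendsto_of_measure_zero_eq_le {μ : Measure (Boundary k)} [IsProbabilityMeasure μ]
    {f : ℕ → Boundary k → Boundary k} {y : Boundary k}
    (hf : ∀ n, μ {x | (f n x).1 0 = y.1 0} ≤ 2⁻¹) :
    ¬ ∀ᵐ x ∂μ, Tendsto (fun n => f n x) atTop (𝓝 y) := by
  intro h
  have hc : Continuous fun x : Boundary k => x.1 0 :=
    (continuous_apply 0).comp continuous_subtype_val
  have hev : ∀ᵐ x ∂μ, x ∈ ⋃ N, ⋂ n ≥ N, {x | (f n x).1 0 = y.1 0} := by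
    filter_upwards [h] with x hx
    have : ∀ᶠ n in atTop, (f n x).1 0 = y.1 0 :=
      ((hc.tendsto y).comp hx) ((isOpen_discrete {y.1 0}).mem_nhds rfl)
    simpa using this
  have hmono : Monotone fun N => ⋂ n ≥ N, {x | (f n x).1 0 = y.1 0} :=
    fun M N hMN => Set.biInter_mono (fun n hn => le_trans hMN hn) fun _ _ => subset_rfl
  have hle : μ (⋃ N, ⋂ n ≥ N, {x | (f n x).1 0 = y.1 0}) ≤ 2⁻¹ := by
    rw [hmono.measure_iUnion]
    exact iSup_le fun N => (measure_mono (Set.biInter_subset_of_mem le_rfl)).trans (hf N)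
  have h1 : (1 : ℝ≥0∞) ≤ 2⁻¹ := by
    rw [← measure_univ (μ := μ)]
    exact (measure_mono_ae (hev.mono fun x hx _ => hx)).trans hle
  exact absurd h1 (by norm_num)

end Median

theorem cyl_el (a : L k) : Cyl k (el k a) = {x | x.1 0 = a} := by
  ext x
  have h : (el k a).toWord = [a] := toWord_mk_of_isReduced FreeGroup.IsReduced.singleton
  simp only [Cyl, Set.mem_ofPred_eq]
  rw [h]
  simp

theorem no_constant_limit_after_conjugation (k : ℕ) (hk : 2 ≤ k)
    (μA : Measure (Boundary k)) [IsProbabilityMeasure μA]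
    (hμA : ∀ v : F k, v ≠ 1 →
      μA (Cyl k v) = ((2 * k : ℝ≥0∞) * (2 * k - 1) ^ (wordLength k v - 1))⁻¹)
    (bd : MulAut (F k) → Boundary k → Boundary k)
    (hbd : ∀ Φ : MulAut (F k), IsBdryExt k Φ (bd Φ))
    (Φ : ℕ → MulAut (F k)) :
    ∃ v : ℕ → F k, ∃ ι : ℕ → ℕ, StrictMono ι ∧
      ¬ ∃ κ : ℕ → ℕ, StrictMono κ ∧ ∃ y : Boundary k,
        ∀ᵐ x ∂μA, Tendsto
          (fun j => bd ((MulAut.conj (v (ι (κ j))))⁻¹ * Φ (ι (κ j))) x) atTop (𝓝 y) := by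
  have hone : ∀ a, μA {x | x.1 0 = a} < 2⁻¹ := by
    intro a
    have h : (el k a).toWord = [a] := toWord_mk_of_isReduced FreeGroup.IsReduced.singleton
    rw [← cyl_el, hμA _ fun h1 => by simp [h1] at h]
    simp only [wordLength, h, List.length_singleton, Nat.sub_self, pow_zero, mul_one,
      ENNReal.inv_lt_inv]
    exact_mod_cast (by omega : 2 < 2 * k)
  choose v hv using exists_conj_measure_zero_eq_le hone hbd
  refine ⟨fun n => v (Φ n), id, strictMono_id, ?_⟩
  rintro ⟨κ, -, y, hy⟩
  exact not_ae_tendsto_of_measure_zero_eq_le (fun n => hv (Φ (κ n)) (y.1 0)) hy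

end

end FGC
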